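/- Let G be a graph on n vertices with minimum degree at least d and matching number ν(G) ≤ k. If 2 ≤ r ≤ k-1, n > (2k+1)^5 and N_r(G) > max{ h_r(n, 2k+1, d), h_r(n, 2k+1, k-2) }, then G is isomorphic to a subgraph of H(n, 2k+1, k) or of H(n, 2k+1, k-1). -/

import Mathlib

open SimpleGraph

/-- The degree of a vertex `v` in a graph `G` (as the cardinality of its neighbor set). -/
noncomputable def degN {V : Type*} (G : SimpleGraph V) (v : V) : ℕ :=
  (G.neighborSet v).ncard

/-- A linear forest: an acyclic graph all of whose vertices have degree at most `2`,
i.e. a forest whose connected components are paths and isolated vertices. -/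
def IsLinearForest {V : Type*} (H : SimpleGraph V) : Prop :=
  H.IsAcyclic ∧ ∀ v, degN H v ≤ 2

/-- `G` is `𝓛ₖ`-free: it contains no linear forest with exactly `k` edges as a subgraph. -/
def LinearForestFree {V : Type*} (k : ℕ) (G : SimpleGraph V) : Prop :=
  ∀ H : SimpleGraph V, H ≤ G → IsLinearForest H → H.edgeSet.ncard ≠ k

/-- `Nr r G` is the number of `r`-cliques of `G`. -/
noncomputable def Nr {V : Type*} (r : ℕ) (G : SimpleGraph V) : ℕ :=
  {s : Finset V | G.IsNClique r s}.ncard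

/-- `hr r n k a = C(k-a, r) + (n-k+a) * C(a, r-1)` (as an integer). -/
def hr (r n k a : ℕ) : ℤ :=
  (Nat.choose (k - a) r : ℤ) + ((n : ℤ) - (k : ℤ) + (a : ℤ)) * (Nat.choose a (r - 1) : ℤ)

/-- The graph `H(n,k,a)`: vertices `0,…,a-1` form the set `A`, vertices `a,…,k-a-1` form
the set `B`, the remaining `n-k+a` vertices form the set `C`; the edges are all edges inside
`A ∪ B` together with all edges between `A` and `C`. -/
def HGraph (n k a : ℕ) : SimpleGraph (Fin n) :=
  SimpleGraph.fromRel (fun u v => (u : ℕ) < a ∨ ((u : ℕ) < k - a ∧ (v : ℕ) < k - a))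

/-- `H⁺(n,k,a)`: the graph `H(n,k,a)` with one extra edge inside `C`
(between the first two vertices of `C`). -/
def HplusGraph (n k a : ℕ) : SimpleGraph (Fin n) :=
  SimpleGraph.fromRel (fun u v => (u : ℕ) < a ∨ ((u : ℕ) < k - a ∧ (v : ℕ) < k - a)
    ∨ ((u : ℕ) = k - a ∧ (v : ℕ) = k - a + 1))

/-- `H⁺⁺(n,k,a)`: the graph `H(n,k,a)` with two extra independent edges inside `C`. -/
def HplusplusGraph (n k a : ℕ) : SimpleGraph (Fin n) :=
  SimpleGraph.fromRel (fun u v => (u : ℕ) < a ∨ ((u : ℕ) < k - a ∧ (v : ℕ) < k - a)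
    ∨ ((u : ℕ) = k - a ∧ (v : ℕ) = k - a + 1)
    ∨ ((u : ℕ) = k - a + 2 ∧ (v : ℕ) = k - a + 3))

/-- `G` is isomorphic to a subgraph of `H`. -/
def IsoSubgraph {V W : Type*} (G : SimpleGraph V) (H : SimpleGraph W) : Prop :=
  ∃ f : V ↪ W, ∀ u v, G.Adj u v → H.Adj (f u) (f v)

section Binomial

/-- Supermodularity of `m ↦ m.choose r`. -/
lemma choose_add_choose_le (a x y r : ℕ) :
    (a + x).choose r + (a + y).choose r ≤ (a + x + y).choose r + a.choose r := by
  cases r with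
  | zero => simp
  | succ r =>
    induction y with
    | zero => simp
    | succ y ih =>
      have h := Nat.choose_le_choose r (show a + y ≤ a + x + y by omega)
      have h1 := Nat.choose_succ_succ (a + y) r
      have h2 := Nat.choose_succ_succ (a + x + y) r
      simp only [← add_assoc, Nat.succ_eq_add_one] at *
      omega

lemma choose_add_mul_choose_le (s x t : ℕ) :
    s.choose (t + 1) + x * s.choose t ≤ (s + x).choose (t + 1) := by
  induction x with
  | zero => simp
  | succ x ih =>
    have h := Nat.choose_le_choose t (Nat.le_add_right s x)
    have h1 := Nat.choose_succ_succ (s + x) t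
    simp only [← add_assoc, Nat.succ_eq_add_one] at *
    rw [h1, add_mul, one_mul]
    omega

/-- Merging parts of sizes `c i` into a single part of size `2 * m + 1`, the other parts becoming
singletons, does not decrease the number of `(t + 1)`-sets contained in the union of a fixed
`s`-set with one part. -/
lemma sum_choose_add_le {ι : Type*} (T : Finset ι) (c : ι → ℕ) (s t m : ℕ)
    (hm : ∑ i ∈ T, c i / 2 ≤ m) :
    ∑ i ∈ T, (s + c i).choose (t + 1) + (2 * m + 1) * s.choose t + s.choose (t + 1) ≤
      (s + (2 * m + 1)).choose (t + 1) + T.card * s.choose (t + 1) +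
        (∑ i ∈ T, c i) * s.choose t := by
  classical
  induction T using Finset.induction_on generalizing m with
  | empty =>
    have := choose_add_mul_choose_le s (2 * m + 1) t
    simp only [Finset.sum_empty, Finset.card_empty]
    omega
  | insert i T hi ih =>
    rw [Finset.sum_insert hi] at hm
    obtain ⟨m', rfl⟩ : ∃ m', m = c i / 2 + m' := ⟨m - c i / 2, by omega⟩
    have ih' := ih m' (by omega)
    rw [Finset.sum_insert hi, Finset.sum_insert hi, Finset.card_insert_of_notMem hi]
    suffices (s + c i).choose (t + 1) + (s + (2 * m' + 1)).choose (t + 1) +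
        2 * (c i / 2) * s.choose t ≤ (s + (2 * (c i / 2 + m') + 1)).choose (t + 1) +
          s.choose (t + 1) + c i * s.choose t by
      nlinarith
    rcases Nat.mod_two_eq_zero_or_one (c i) with h | h
    · have hc : 2 * (c i / 2) = c i := by omega
      have := choose_add_choose_le s (c i) (2 * m' + 1) (t + 1)
      rw [show s + (2 * (c i / 2 + m') + 1) = s + c i + (2 * m' + 1) by omega, hc]
      omega
    · have hc : c i = 2 * (c i / 2) + 1 := by omega
      have := choose_add_choose_le (s + 1) (2 * (c i / 2)) (2 * m') (t + 1)
      have h1 := Nat.choose_succ_succ s t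
      rw [show s + (2 * (c i / 2 + m') + 1) = s + 1 + 2 * (c i / 2) + 2 * m' by omega,
        show s + (2 * m' + 1) = s + 1 + 2 * m' by omega]
      have h2 : (s + c i) = s + 1 + 2 * (c i / 2) := by omega
      have h3 : c i * s.choose t = 2 * (c i / 2) * s.choose t + s.choose t := by
        conv_lhs => rw [hc, add_mul, one_mul]
      rw [h2, h3]
      simp only [Nat.succ_eq_add_one] at h1
      omega

/-- A function on an integer interval with nondecreasing increments attains its maximum at an
endpoint. -/
lemma le_max_of_increments_le (f : ℕ → ℤ) {d s e : ℕ} (hds : d ≤ s) (hse : s ≤ e)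
    (hf : ∀ a, a + 2 ≤ e → f (a + 1) - f a ≤ f (a + 2) - f (a + 1)) :
    f s ≤ max (f d) (f e) := by
  rcases hse.eq_or_lt with rfl | hse
  · exact le_max_right _ _
  rcases le_total (f s) (f (s + 1)) with h | h
  · refine le_max_of_le_right ?_
    have key : ∀ j, s + j + 1 ≤ e → f s ≤ f (s + j + 1) ∧ f (s + j) ≤ f (s + j + 1) := by
      intro j
      induction j with
      | zero => exact fun _ => ⟨h, h⟩
      | succ j ih =>
        intro hj
        have h1 := ih (by omega)
        have h2 := hf (s + j) (by omega)
        simp only [← add_assoc] at *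
        constructor <;> linarith
    have := (key (e - s - 1) (by omega)).1
    rwa [show s + (e - s - 1) + 1 = e by omega] at this
  · refine le_max_of_le_left ?_
    have key : ∀ j, j ≤ s → f s ≤ f (s - j) ∧ f (s - j + 1) ≤ f (s - j) := by
      intro j
      induction j with
      | zero => exact fun _ => ⟨le_rfl, h⟩
      | succ j ih =>
        intro hj
        have h1 := ih (by omega)
        have h2 := hf (s - (j + 1)) (by omega)
        rw [show s - (j + 1) + 2 = s - j + 1 by omega] at h2
        rw [show s - (j + 1) + 1 = s - j by omega] at *
        constructor <;> linarith
    have := (key (s - d) (by omega)).1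
    rwa [show s - (s - d) = d by omega] at this

lemma hr_increments_le (t n K a : ℕ) (hK : K ≤ n) (ha : a + 2 ≤ K) :
    hr (t + 1) n K (a + 1) - hr (t + 1) n K a ≤
      hr (t + 1) n K (a + 2) - hr (t + 1) n K (a + 1) := by
  obtain ⟨N, rfl⟩ := Nat.exists_eq_add_of_le hK
  obtain ⟨m, rfl⟩ := Nat.exists_eq_add_of_le ha
  have h1 := choose_add_choose_le m 1 1 (t + 1)
  have h2 := choose_add_choose_le a 1 1 t
  have h3 := Nat.choose_le_choose t (show a + 1 ≤ a + 2 by omega)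
  unfold hr
  rw [show a + 2 + m - a = m + 1 + 1 by omega, show a + 2 + m - (a + 1) = m + 1 by omega,
    show a + 2 + m - (a + 2) = m by omega, Nat.add_sub_cancel]
  rw [add_assoc a 1 1] at h2
  zify at h1 h2 h3
  push_cast
  have hx : (0 : ℤ) ≤ (N : ℤ) + a := by positivity
  nlinarith [mul_le_mul_of_nonneg_left h2 hx]

lemma hr_le_max (t n K : ℕ) {d s e : ℕ} (hK : K ≤ n) (hds : d ≤ s) (hse : s ≤ e) (heK : e ≤ K) :
    hr (t + 1) n K s ≤ max (hr (t + 1) n K d) (hr (t + 1) n K e) :=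
  le_max_of_increments_le (hr (t + 1) n K) hds hse
    fun a ha => hr_increments_le t n K a hK (ha.trans heK)

end Binomial

section Cliques

variable {V β : Type*} [Fintype V] [DecidableEq V] [DecidableEq β]

/-- If no edge of `G` outside `S` joins different fibres of `f`, then every clique lies in the
union of `S` with one fibre. -/
lemma Nr_add_card_mul_choose_le (G : SimpleGraph V) (S : Finset V) (f : V → β) (r : ℕ)
    (hf : ∀ x y, x ∉ S → y ∉ S → G.Adj x y → f x = f y) :
    Nr r G + (Sᶜ.image f).card * S.card.choose r ≤
      S.card.choose r +
        ∑ b ∈ Sᶜ.image f, (S.card + (Sᶜ.filter fun x => f x = b).card).choose r := by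
  set T := Sᶜ.image f
  set P : β → Finset V := fun b => Sᶜ.filter fun x => f x = b
  let F : Finset (Finset V) := S.powersetCard r ∪
    T.biUnion fun b => (S ∪ P b).powersetCard r \ S.powersetCard r
  have hsub : {s : Finset V | G.IsNClique r s} ⊆ (F : Set (Finset V)) := by
    intro s hs
    obtain ⟨hcl, hcard⟩ := hs
    by_cases hsS : s ⊆ S
    · simp [F, Finset.mem_powersetCard, hsS, hcard]
    · obtain ⟨x, hxs, hxS⟩ := Finset.not_subset.1 hsS
      have hx : f x ∈ T := Finset.mem_image_of_mem f (by simpa using hxS)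
      refine Finset.mem_coe.2 (Finset.mem_union_right _ (Finset.mem_biUnion.2 ⟨f x, hx, ?_⟩))
      simp only [Finset.mem_sdiff, Finset.mem_powersetCard, hsS, hcard,
        not_false_eq_true, and_true]
      intro y hy
      by_cases hyS : y ∈ S
      · exact Finset.mem_union_left _ hyS
      · refine Finset.mem_union_right _ ?_
        simp only [P, Finset.mem_filter, Finset.mem_compl, hyS, not_false_eq_true, true_and]
        by_cases hyx : y = x
        · rw [hyx]
        · exact hf y x hyS hxS (hcl hy hxs hyx)
  have hP : ∀ b, (S ∪ P b).card = S.card + (P b).card := fun b =>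
    Finset.card_union_of_disjoint <| Finset.disjoint_left.2 fun x hx hx' => by
      simp only [P, Finset.mem_filter, Finset.mem_compl] at hx'
      exact hx'.1 hx
  have hD : ∀ b, ((S ∪ P b).powersetCard r \ S.powersetCard r).card + S.card.choose r =
      (S.card + (P b).card).choose r := fun b => by
    rw [← hP, ← Finset.card_powersetCard, ← Finset.card_powersetCard]
    exact Finset.card_sdiff_add_card_eq_card (Finset.powersetCard_mono Finset.subset_union_left)
  calc Nr r G + T.card * S.card.choose r ≤ F.card + T.card * S.card.choose r := by
        gcongr
        rw [← Set.ncard_coe_finset]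
        exact Set.ncard_le_ncard hsub (Finset.finite_toSet F)
    _ ≤ S.card.choose r + ∑ b ∈ T, ((S ∪ P b).powersetCard r \ S.powersetCard r).card +
          T.card * S.card.choose r := by
        gcongr
        refine (Finset.card_union_le _ _).trans ?_
        rw [Finset.card_powersetCard]
        gcongr
        exact Finset.card_biUnion_le
    _ = _ := by
        rw [add_assoc, ← smul_eq_mul, ← Finset.sum_const, ← Finset.sum_add_distrib]
        simp only [hD, P]

lemma Nr_le_hr (G : SimpleGraph V) (S : Finset V) (f : V → β) (t k : ℕ)
    (hf : ∀ x y, x ∉ S → y ∉ S → G.Adj x y → f x = f y)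
    (hk : S.card + ∑ b ∈ Sᶜ.image f, (Sᶜ.filter fun x => f x = b).card / 2 ≤ k) :
    (Nr (t + 1) G : ℤ) ≤ hr (t + 1) (Fintype.card V) (2 * k + 1) S.card := by
  have h1 := Nr_add_card_mul_choose_le G S f (t + 1) hf
  have h2 := sum_choose_add_le (Sᶜ.image f) (fun b => (Sᶜ.filter fun x => f x = b).card)
    S.card t (k - S.card) (by omega)
  rw [← Finset.card_eq_sum_card_image f Sᶜ] at h2
  have h3 := S.card_add_card_compl
  obtain ⟨m, hm⟩ := Nat.exists_eq_add_of_le (show S.card ≤ k by omega)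
  have h4 : Nr (t + 1) G + (2 * m + 1) * S.card.choose t ≤
      (S.card + (2 * m + 1)).choose (t + 1) + Sᶜ.card * S.card.choose t := by
    rw [hm, Nat.add_sub_cancel_left] at h2
    omega
  unfold hr
  rw [show 2 * k + 1 - S.card = S.card + (2 * m + 1) by omega, Nat.add_sub_cancel, ← h3, hm]
  zify at h4
  push_cast
  linarith

end Cliques

section Embedding

variable {V : Type*} [Fintype V] [DecidableEq V]

/-- The vertices can be numbered so that those of `S` come first, followed by those of `B`. -/
lemma exists_embedding_fin_lt (S B : Finset V) (hSB : Disjoint S B) {n : ℕ}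
    (hn : Fintype.card V = n) :
    ∃ e : V ↪ Fin n, (∀ x ∈ S, (e x : ℕ) < S.card) ∧
      ∀ x ∈ S ∪ B, (e x : ℕ) < S.card + B.card := by
  let l₁ := S.toList ++ B.toList
  let l := l₁ ++ (S ∪ B)ᶜ.toList
  have hl : ∀ x, x ∈ l := fun x => by
    simp only [l, l₁, List.mem_append, Finset.mem_toList, Finset.mem_compl, Finset.mem_union]
    tauto
  have hlen : l.length = n := by
    have h := (S ∪ B).card_add_card_compl
    rw [Finset.card_union_of_disjoint hSB] at h
    simp only [l, l₁, List.length_append, Finset.length_toList]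
    omega
  refine ⟨⟨fun x => ⟨l.idxOf x, hlen ▸ List.idxOf_lt_length_of_mem (hl x)⟩, fun x y hxy => ?_⟩,
    fun x hx => ?_, fun x hx => ?_⟩
  · exact (List.idxOf_inj (hl x)).1 (Fin.mk.inj hxy)
  · have hx' : x ∈ S.toList := Finset.mem_toList.2 hx
    have := List.idxOf_lt_length_of_mem hx'
    simpa [l, l₁, List.idxOf_append_of_mem hx', hx] using this
  · have hx' : x ∈ l₁ := by simpa [l₁] using hx
    have := List.idxOf_lt_length_of_mem hx'
    change (l₁ ++ _).idxOf x < _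
    rw [List.idxOf_append_of_mem hx']
    simpa [l₁] using this

/-- If every edge of `G` outside `S` lies in a small set `B`, then `G` embeds in
`H(n, K, |S|)`. -/
lemma isoSubgraph_HGraph (G : SimpleGraph V) (S B : Finset V) (hSB : Disjoint S B) {n K : ℕ}
    (hn : Fintype.card V = n) (hB : 2 * S.card + B.card ≤ K)
    (hG : ∀ x y, x ∉ S → y ∉ S → G.Adj x y → x ∈ B ∧ y ∈ B) :
    IsoSubgraph G (HGraph n K S.card) := by
  obtain ⟨e, he, he'⟩ := exists_embedding_fin_lt S B hSB hn
  refine ⟨e, fun u v huv => ?_⟩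
  refine (SimpleGraph.fromRel_adj _ _ _).2 ⟨e.injective.ne huv.ne, ?_⟩
  by_cases hu : u ∈ S
  · exact Or.inl (Or.inl (he u hu))
  by_cases hv : v ∈ S
  · exact Or.inr (Or.inl (he v hv))
  obtain ⟨hu, hv⟩ := hG u v hu hv huv
  have h1 := he' u (Finset.mem_union_right _ hu)
  have h2 := he' v (Finset.mem_union_right _ hv)
  exact Or.inl (Or.inr ⟨by omega, by omega⟩)

end Embedding

section TutteBerge

universe u

variable {V : Type u}

lemma SimpleGraph.Subgraph.IsMatching.ncard_verts_le [Finite V] {G : SimpleGraph V}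
    {M : G.Subgraph} (hM : M.IsMatching) : M.verts.ncard ≤ 2 * M.edgeSet.ncard := by
  classical
  have hfin : M.edgeSet.Finite := Set.toFinite _
  have hsub : M.verts ⊆ (hfin.toFinset.biUnion fun e => e.toFinset : Finset V) := by
    intro x hx
    obtain ⟨y, hy, -⟩ := hM hx
    simp only [Finset.coe_biUnion, Set.mem_iUnion, Finset.mem_coe, Sym2.mem_toFinset]
    exact ⟨s(x, y), hfin.mem_toFinset.2 (Subgraph.mem_edgeSet.2 hy), Sym2.mem_mk_left x y⟩
  calc M.verts.ncard ≤ (hfin.toFinset.biUnion fun e => e.toFinset : Finset V).card := by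
        rw [← Set.ncard_coe_finset]
        exact Set.ncard_le_ncard hsub (Finset.finite_toSet _)
    _ ≤ hfin.toFinset.card * 2 := Finset.card_biUnion_le_card_mul _ _ _ fun e _ => by
        rw [Sym2.card_toFinset]
        split_ifs <;> omega
    _ = 2 * M.edgeSet.ncard := by rw [Set.ncard_eq_toFinset_card _ hfin, mul_comm]

/-- The graph obtained from `G` by adding a vertex for each element of `W`, adjacent to all other
vertices. -/
def addUniversal (G : SimpleGraph V) (W : Type*) : SimpleGraph (V ⊕ W) where
  Adj x y := x ≠ y ∧ ∀ a b, x = Sum.inl a → y = Sum.inl b → G.Adj a b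
  symm := ⟨fun _ _ h => ⟨h.1.symm, fun a b ha hb => (h.2 b a hb ha).symm⟩⟩
  loopless := ⟨fun _ h => h.1 rfl⟩

/-- The restriction to `G` of a subgraph of `addUniversal G W`, without its isolated vertices. -/
def restrictAddUniversal {G : SimpleGraph V} {W : Type*} (M : (addUniversal G W).Subgraph) :
    G.Subgraph where
  verts := {v | ∃ w, M.Adj (Sum.inl v) (Sum.inl w)}
  Adj v w := M.Adj (Sum.inl v) (Sum.inl w)
  adj_sub h := (M.adj_sub h).2 _ _ rfl rfl
  edge_vert h := ⟨_, h⟩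
  symm := ⟨fun _ _ h => h.symm⟩

lemma isMatching_restrictAddUniversal {G : SimpleGraph V} {W : Type*}
    {M : (addUniversal G W).Subgraph} (hM : M.IsMatching) :
    (restrictAddUniversal M).IsMatching := by
  rintro v ⟨w, hw⟩
  exact ⟨w, hw, fun w' hw' => Sum.inl_injective (hM.eq_of_adj_left hw' hw)⟩

lemma card_le_of_isPerfectMatching_addUniversal [Finite V] {G : SimpleGraph V} {W : Type*}
    [Finite W] {M : (addUniversal G W).Subgraph} (hM : M.IsPerfectMatching) :
    Nat.card V ≤ (restrictAddUniversal M).verts.ncard + Nat.card W := by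
  have key : ∀ v : ((restrictAddUniversal M).vertsᶜ : Set V), ∃ w : W,
      M.Adj (Sum.inl v.1) (Sum.inr w) := by
    rintro ⟨v, hv⟩
    obtain ⟨x, hx, -⟩ := hM.1 (hM.2 (Sum.inl v))
    rcases x with x | x
    · exact (hv ⟨x, hx⟩).elim
    · exact ⟨x, hx⟩
  choose g hg using key
  have hinj : Function.Injective g := fun v w hvw => by
    have h := hg v
    rw [hvw] at h
    exact Subtype.ext (Sum.inl_injective (hM.1.eq_of_adj_right h (hg w)))
  have h1 := Nat.card_le_card_of_injective g hinj
  rw [Nat.card_coe_set_eq] at h1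
  have h2 := Set.ncard_add_ncard_compl (restrictAddUniversal M).verts
  omega

lemma range_inr_subset_of_isTutteViolator [Finite V] {G : SimpleGraph V} {W : Type*} [Finite W]
    (heven : Even (Nat.card (V ⊕ W))) {u : Set (V ⊕ W)}
    (hu : (addUniversal G W).IsTutteViolator u) : Set.range Sum.inr ⊆ u := by
  rintro _ ⟨j, rfl⟩
  by_contra hj
  unfold IsTutteViolator at hu
  set H := ((⊤ : (addUniversal G W).Subgraph).deleteVerts u)
  have hjH : Sum.inr j ∈ H.verts := ⟨trivial, hj⟩
  have hall : ∀ c : H.coe.ConnectedComponent, c = H.coe.connectedComponentMk ⟨_, hjH⟩ := by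
    refine ConnectedComponent.ind fun x => ?_
    by_cases hx : x = ⟨_, hjH⟩
    · rw [hx]
    · refine ConnectedComponent.sound (Adj.reachable ?_)
      have hx' : x.1 ≠ Sum.inr j := fun h => hx (Subtype.ext h)
      refine Subgraph.deleteVerts_adj.2 ⟨trivial, x.2.2, trivial, hj, ?_⟩
      exact ⟨hx', fun a b _ hb => by cases hb⟩
  have hle : H.coe.oddComponents.ncard ≤ 1 :=
    (Set.ncard_le_one_iff (Set.toFinite _)).2 fun _ _ => (hall _).trans (hall _).symm
  have hu0 : u.ncard = 0 := by omega
  have h1 : H.coe.oddComponents.ncard = 1 := by omega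
  have hodd := (odd_ncard_oddComponents H.coe).1 (by rw [h1]; exact odd_one)
  have hverts : H.verts = Set.univ := by
    rw [Set.ncard_eq_zero] at hu0
    simp [H, hu0]
  rw [hverts, Nat.card_congr (Equiv.Set.univ _)] at hodd
  exact Nat.not_even_iff_odd.2 hodd heven

/-- A form of the **Tutte–Berge formula**: the fibres of `f` outside `S` are unions of components
of `G - S`, and so many of them are odd that a maximum matching misses at least
`|V| - 2 * k - 1` vertices. -/
lemma exists_odd_fibers_of_matching_le [Fintype V] [DecidableEq V] (G : SimpleGraph V) (k : ℕ)
    (hnu : ∀ M : G.Subgraph, M.IsMatching → M.edgeSet.ncard ≤ k)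
    (hk : 2 * k + 2 ≤ Fintype.card V) :
    ∃ (β : Type u) (_ : DecidableEq β) (S : Finset V) (f : V → β),
      (∀ x y, x ∉ S → y ∉ S → G.Adj x y → f x = f y) ∧
      S.card + Fintype.card V ≤
        ((Sᶜ.image f).filter fun b => Odd (Sᶜ.filter fun x => f x = b).card).card +
          2 * k + 1 := by
  classical
  obtain ⟨t, ht⟩ := Nat.exists_eq_add_of_le hk
  obtain ⟨u, hu⟩ : ∃ u, (addUniversal G (Fin t)).IsTutteViolator u := by
    by_contra! hu
    obtain ⟨M, hM⟩ := tutte.2 hu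
    have h1 := card_le_of_isPerfectMatching_addUniversal hM
    have h2 := (isMatching_restrictAddUniversal hM.1).ncard_verts_le
    have h3 := hnu _ (isMatching_restrictAddUniversal hM.1)
    rw [Nat.card_eq_fintype_card, Nat.card_eq_fintype_card, Fintype.card_fin] at h1
    omega
  have heven : Even (Nat.card (V ⊕ Fin t)) := by
    rw [Nat.card_eq_fintype_card, Fintype.card_sum, Fintype.card_fin, ht]
    exact ⟨k + 1 + t, by omega⟩
  have hru := range_inr_subset_of_isTutteViolator heven hu
  unfold IsTutteViolator at hu
  set H := ((⊤ : (addUniversal G (Fin t)).Subgraph).deleteVerts u) with hH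
  let S : Finset V := Finset.univ.filter fun v => Sum.inl v ∈ u
  have hS : ∀ v, v ∉ S ↔ Sum.inl v ∈ H.verts := fun v => by simp [S, hH]
  let f : V → Option H.coe.ConnectedComponent := fun v =>
    if h : Sum.inl v ∈ H.verts then some (H.coe.connectedComponentMk ⟨_, h⟩) else none
  have hf : ∀ v (h : Sum.inl v ∈ H.verts), f v = some (H.coe.connectedComponentMk ⟨_, h⟩) :=
    fun v h => dif_pos h
  have hucard : u.ncard = S.card + t := by
    have : u = (S.map Function.Embedding.inl ∪ Finset.univ.map Function.Embedding.inr :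
        Finset (V ⊕ Fin t)) := by
      ext x
      rcases x with x | x
      · simp [S]
      · simpa using hru ⟨x, rfl⟩
    rw [this, Set.ncard_coe_finset, Finset.card_union_of_disjoint, Finset.card_map,
      Finset.card_map, Finset.card_univ, Fintype.card_fin]
    simp [Finset.disjoint_left]
  have hinl : ∀ x : H.verts, ∃ v, ∃ h : Sum.inl v ∈ H.verts, x = ⟨Sum.inl v, h⟩ := by
    rintro ⟨x | x, hx⟩
    · exact ⟨x, hx, rfl⟩
    · exact (hx.2 (hru ⟨x, rfl⟩)).elim
  have hfiber : ∀ c : H.coe.ConnectedComponent,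
      (Sᶜ.filter fun x => f x = some c).card = c.supp.ncard := fun c => by
    rw [← Set.ncard_coe_finset]
    refine Set.ncard_congr (fun v hv => ⟨Sum.inl v, ?_⟩) ?_ ?_ ?_
    · rw [← hS]
      simpa using (Finset.mem_filter.1 (Finset.mem_coe.1 hv)).1
    · intro v hv
      have h1 := (Finset.mem_filter.1 (Finset.mem_coe.1 hv)).2
      rw [hf v ((hS v).1 (by simpa using (Finset.mem_filter.1 (Finset.mem_coe.1 hv)).1))] at h1
      exact Option.some.inj h1
    · intro v w _ _ h
      exact Sum.inl_injective (congrArg Subtype.val h)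
    · intro x hx
      obtain ⟨v, hv, rfl⟩ := hinl x
      refine ⟨v, ?_, rfl⟩
      simp only [Finset.coe_filter, Finset.mem_compl, Set.mem_ofPred_eq]
      exact ⟨(hS v).2 hv, (hf v hv).trans (congrArg some hx)⟩
  refine ⟨_, inferInstance, S, f, fun x y hx hy hxy => ?_, ?_⟩
  · rw [hS] at hx hy
    rw [hf x hx, hf y hy]
    refine congrArg some (ConnectedComponent.sound (Adj.reachable ?_))
    refine Subgraph.deleteVerts_adj.2 ⟨trivial, hx.2, trivial, hy.2, ?_⟩
    refine ⟨Sum.inl_injective.ne hxy.ne, fun a b ha hb => ?_⟩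
    cases ha
    cases hb
    exact hxy
  · suffices H.coe.oddComponents.ncard ≤
        ((Sᶜ.image f).filter fun b => Odd (Sᶜ.filter fun x => f x = b).card).card by
      omega
    rw [← Set.ncard_coe_finset]
    refine Set.ncard_le_ncard_of_injOn some (fun c hc => ?_) (Option.some_injective _).injOn
    simp only [Finset.coe_filter, Set.mem_ofPred_eq, hfiber]
    refine ⟨?_, hc⟩
    obtain ⟨x, rfl⟩ := c.exists_rep
    obtain ⟨v, hv, rfl⟩ := hinl x
    exact Finset.mem_image.2 ⟨v, by simpa using (hS v).2 hv, hf v hv⟩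

/-- If `G` has no matching with more than `k` edges, then some set `S` of vertices splits the
rest into parts of total matching capacity at most `k - |S|`. -/
lemma exists_card_add_sum_half_le [Fintype V] [DecidableEq V] (G : SimpleGraph V) (k : ℕ)
    (hnu : ∀ M : G.Subgraph, M.IsMatching → M.edgeSet.ncard ≤ k)
    (hk : 2 * k + 2 ≤ Fintype.card V) :
    ∃ (β : Type u) (_ : DecidableEq β) (S : Finset V) (f : V → β),
      (∀ x y, x ∉ S → y ∉ S → G.Adj x y → f x = f y) ∧
      S.card + ∑ b ∈ Sᶜ.image f, (Sᶜ.filter fun x => f x = b).card / 2 ≤ k := by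
  obtain ⟨β, hβ, S, f, hf, hle⟩ := exists_odd_fibers_of_matching_le G k hnu hk
  refine ⟨β, hβ, S, f, hf, ?_⟩
  have h1 : Sᶜ.card = ((Sᶜ.image f).filter fun b => Odd (Sᶜ.filter fun x => f x = b).card).card +
      2 * ∑ b ∈ Sᶜ.image f, (Sᶜ.filter fun x => f x = b).card / 2 := by
    rw [Finset.card_eq_sum_card_image f Sᶜ, Finset.card_filter, Finset.mul_sum,
      ← Finset.sum_add_distrib]
    refine Finset.sum_congr rfl fun b _ => ?_
    split_ifs with h
    · rw [Nat.odd_iff] at h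
      omega
    · rw [Nat.odd_iff] at h
      omega
  have h2 := S.card_add_card_compl
  omega

end TutteBerge

section Structure

variable {V β : Type*} [Fintype V] [DecidableEq V] [DecidableEq β]

lemma le_card_of_mindeg (G : SimpleGraph V) (S : Finset V) (f : V → β) (k d : ℕ)
    (hmindeg : ∀ v, d ≤ degN G v) (hn : 3 * k < Fintype.card V)
    (hf : ∀ x y, x ∉ S → y ∉ S → G.Adj x y → f x = f y)
    (hk : S.card + ∑ b ∈ Sᶜ.image f, (Sᶜ.filter fun x => f x = b).card / 2 ≤ k) :
    d ≤ S.card := by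
  obtain ⟨b, hb, hb1⟩ : ∃ b ∈ Sᶜ.image f, (Sᶜ.filter fun x => f x = b).card ≤ 1 := by
    by_contra! h
    have h1 : Sᶜ.card ≤ 3 * ∑ b ∈ Sᶜ.image f, (Sᶜ.filter fun x => f x = b).card / 2 := by
      rw [Finset.card_eq_sum_card_image f Sᶜ, Finset.mul_sum]
      refine Finset.sum_le_sum fun b hb => ?_
      have := h b hb
      omega
    have h2 := S.card_add_card_compl
    omega
  obtain ⟨x, hx, rfl⟩ := Finset.mem_image.1 hb
  refine (hmindeg x).trans ?_
  rw [degN, ← Set.ncard_coe_finset]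
  refine Set.ncard_le_ncard (fun y hy => ?_) (Finset.finite_toSet S)
  by_contra hyS
  rw [Finset.mem_compl] at hx
  rw [Finset.mem_coe] at hyS
  have hxy : G.Adj x y := hy
  refine hxy.ne (Finset.card_le_one.1 hb1 x ?_ y ?_)
  · simpa using hx
  · simpa using ⟨hyS, (hf x y hx hyS hxy).symm⟩

/-- If the parts outside `S` have total matching capacity at most one, then all edges outside `S`
lie in one part with at most three vertices. -/
lemma isoSubgraph_HGraph_of_sum_half_le_one (G : SimpleGraph V) (S : Finset V) (f : V → β)
    {n m : ℕ}
    (hn : Fintype.card V = n) (hm : m ≤ 1)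
    (hf : ∀ x y, x ∉ S → y ∉ S → G.Adj x y → f x = f y)
    (hk : ∑ b ∈ Sᶜ.image f, (Sᶜ.filter fun x => f x = b).card / 2 ≤ m) :
    IsoSubgraph G (HGraph n (2 * (S.card + m) + 1) S.card) := by
  by_cases h : ∃ b ∈ Sᶜ.image f, 2 ≤ (Sᶜ.filter fun x => f x = b).card
  · obtain ⟨b, hb, hb2⟩ := h
    have h1 := Finset.add_sum_erase (Sᶜ.image f)
      (fun b => (Sᶜ.filter fun x => f x = b).card / 2) hb
    refine isoSubgraph_HGraph G S (Sᶜ.filter fun x => f x = b) ?_ hn (by omega) ?_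
    · exact Finset.disjoint_left.2 fun x hx hx' => by
        simp only [Finset.mem_filter, Finset.mem_compl] at hx'
        exact hx'.1 hx
    · intro x y hx hy hxy
      have hfxy := hf x y hx hy hxy
      suffices f x = b by simp [hx, hy, this, ← hfxy]
      by_contra hne
      have h2 : 2 ≤ (Sᶜ.filter fun z => f z = f x).card :=
        Finset.one_lt_card.2 ⟨x, by simp [hx], y, by simp [hy, hfxy], hxy.ne⟩
      have hmem : f x ∈ (Sᶜ.image f).erase b :=
        Finset.mem_erase.2 ⟨hne, Finset.mem_image_of_mem f (by simpa using hx)⟩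
      have h3 := Finset.single_le_sum
        (f := fun b => (Sᶜ.filter fun x => f x = b).card / 2) (fun _ _ => Nat.zero_le _) hmem
      omega
  · push Not at h
    refine isoSubgraph_HGraph G S ∅ (Finset.disjoint_empty_right S) hn (by simp; omega) ?_
    intro x y hx hy hxy
    have h1 := h (f x) (Finset.mem_image_of_mem f (by simpa using hx))
    refine (hxy.ne (Finset.card_le_one.1 (Nat.lt_succ_iff.1 h1) x ?_ y ?_)).elim
    · simpa using hx
    · simpa using ⟨hy, (hf x y hx hy hxy).symm⟩

end Structure

/-- stability of Erdős–Gallai, clique version. Let `G` be a graph on `n`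
vertices with minimum degree at least `d` and matching number at most `k`. If `2 ≤ r ≤ k-1`,
`n > (2k+1)^5` and `Nᵣ(G) > max { hᵣ(n,2k+1,d), hᵣ(n,2k+1,k-2) }`, then `G` is isomorphic to
a subgraph of `H(n,2k+1,k)` or of `H(n,2k+1,k-1)`. -/
theorem statement8 {V : Type*} [Fintype V] (G : SimpleGraph V) (n k d r : ℕ)
    (hcard : Fintype.card V = n) (hmindeg : ∀ v, d ≤ degN G v)
    (hnu : ∀ M : G.Subgraph, M.IsMatching → M.edgeSet.ncard ≤ k)
    (hr2 : 2 ≤ r) (hrk : r ≤ k - 1) (hn : (2 * k + 1) ^ 5 < n)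
    (hNr : max (hr r n (2 * k + 1) d) (hr r n (2 * k + 1) (k - 2)) < (Nr r G : ℤ)) :
    IsoSubgraph G (HGraph n (2 * k + 1) k) ∨ IsoSubgraph G (HGraph n (2 * k + 1) (k - 1)) := by
  classical
  have hn5 : 5 * (2 * k + 1) < n := by
    have h1 : 5 ≤ (2 * k + 1) ^ 4 :=
      le_trans (by norm_num) (Nat.pow_le_pow_left (show 3 ≤ 2 * k + 1 by omega) 4)
    calc 5 * (2 * k + 1) ≤ (2 * k + 1) ^ 4 * (2 * k + 1) := by gcongr
      _ = (2 * k + 1) ^ 5 := by ring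
      _ < n := hn
  subst hcard
  obtain ⟨β, hβ, S, f, hf, hle⟩ := exists_card_add_sum_half_le G k hnu (by omega)
  have hSk : S.card = k ∨ S.card = k - 1 := by
    by_contra! hS
    obtain ⟨t, rfl⟩ : ∃ t, r = t + 1 := ⟨r - 1, by omega⟩
    have hdS := le_card_of_mindeg G S f k d hmindeg (by omega) hf hle
    have h1 := Nr_le_hr G S f t k hf hle
    have h2 := hr_le_max t (Fintype.card V) (2 * k + 1) (by omega) hdS
      (show S.card ≤ k - 2 by omega) (by omega)
    exact absurd hNr (not_lt.2 (h1.trans h2))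
  rcases hSk with hS | hS
  · have h := isoSubgraph_HGraph_of_sum_half_le_one G S f rfl (m := 0) (by omega) hf (by omega)
    rw [hS] at h
    exact Or.inl h
  · have h := isoSubgraph_HGraph_of_sum_half_le_one G S f rfl (m := 1) le_rfl hf (by omega)
    rw [hS, show k - 1 + 1 = k by omega] at h
    exact Or.inr h
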